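/- Let ξ : ℝ → ℂ be twice differentiable and define η : (−1,1) → ℂ by η(x) := ξ(√2·artanh x). Then ξ satisfies ξ''(t) = (−1 + 3·tanh²(t/√2))·ξ(t) for all t ∈ ℝ if and only if η is twice differentiable and satisfies the algebraic linear equation (1−x²)²·η''(x) − 2x(1−x²)·η'(x) + (2 − 6x²)·η(x) = 0 for all x ∈ (−1,1). -/

import Mathlib

/-- The real inverse hyperbolic tangent, `artanh x = (1/2)·log((1+x)/(1-x))`,
a bijection from `(-1,1)` to `ℝ` with `tanh (artanh x) = x` there. -/
noncomputable def artanh (x : ℝ) : ℝ := (1 / 2) * Real.log ((1 + x) / (1 - x))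

theorem my_artanh_eq {x : ℝ} (hx : x ∈ Set.Ioo (-1 : ℝ) 1) : artanh x = Real.artanh x := by
  rw [Real.artanh_eq_half_log ⟨hx.1.le, hx.2.le⟩, artanh]

theorem my_hasDeriv {x : ℝ} (hx : x ∈ Set.Ioo (-1 : ℝ) 1) :
    HasDerivAt (fun y => Real.sqrt 2 * artanh y) (Real.sqrt 2 / (1 - x ^ 2)) x := by
  have h1 : (1 + x) ≠ 0 := by linarith [hx.1]
  have h2 : (1 - x) ≠ 0 := by linarith [hx.2]
  have h3 : (1 - x ^ 2) ≠ 0 := by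
    have : 1 - x ^ 2 = (1 + x) * (1 - x) := by ring
    rw [this]; exact mul_ne_zero h1 h2
  have ha : HasDerivAt (fun y : ℝ => 1 + y) 1 x := (hasDerivAt_id x).const_add 1
  have hb : HasDerivAt (fun y : ℝ => 1 - y) (-1) x := (hasDerivAt_id x).const_sub 1
  have := (((ha.fun_div hb h2).log (div_ne_zero h1 h2)).const_mul (1 / 2 : ℝ)).const_mul
    (Real.sqrt 2)
  refine this.congr_deriv ?_
  have : 1 - x ^ 2 = (1 + x) * (1 - x) := by ring
  rw [this]
  field_simp
  ring

theorem my_hasDeriv2 {x : ℝ} (hx : x ∈ Set.Ioo (-1 : ℝ) 1) :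
    HasDerivAt (fun y : ℝ => Real.sqrt 2 / (1 - y ^ 2))
      (Real.sqrt 2 * (2 * x) / (1 - x ^ 2) ^ 2) x := by
  have h3 : (1 - x ^ 2) ≠ 0 := by nlinarith [hx.1, hx.2]
  have hb : HasDerivAt (fun y : ℝ => 1 - y ^ 2) (-(2 * x)) x := by
    simpa using (hasDerivAt_pow 2 x).const_sub 1
  refine ((hasDerivAt_const x (Real.sqrt 2)).fun_div hb h3).congr_deriv ?_
  ring

/-- Algebrisation of the variational equation: with `η(x) = ξ(√2·artanh x)`, the function `ξ`
satisfies `ξ'' = (-1 + 3tanh²(t/√2))ξ` on `ℝ` iff `η` is twice differentiable on `(-1,1)` and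
satisfies `(1-x²)²η'' - 2x(1-x²)η' + (2-6x²)η = 0` there. -/
theorem stmt_7 (ξ : ℝ → ℂ)
    (hξ : ∀ t : ℝ, DifferentiableAt ℝ ξ t ∧ DifferentiableAt ℝ (deriv ξ) t)
    (η : ℝ → ℂ) (hη : ∀ x : ℝ, η x = ξ (Real.sqrt 2 * artanh x)) :
    (∀ t : ℝ, deriv (deriv ξ) t =
        ((-1 + 3 * Real.tanh (t / Real.sqrt 2) ^ 2 : ℝ) : ℂ) * ξ t) ↔
    ((∀ x ∈ Set.Ioo (-1 : ℝ) 1, DifferentiableAt ℝ η x ∧ DifferentiableAt ℝ (deriv η) x) ∧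
      ∀ x ∈ Set.Ioo (-1 : ℝ) 1,
        (1 - (x : ℂ) ^ 2) ^ 2 * deriv (deriv η) x -
          2 * (x : ℂ) * (1 - (x : ℂ) ^ 2) * deriv η x +
          (2 - 6 * (x : ℂ) ^ 2) * η x = 0) := by
  have hd1 : ∀ x ∈ Set.Ioo (-1 : ℝ) 1, HasDerivAt η
      ((Real.sqrt 2 / (1 - x ^ 2)) • deriv ξ (Real.sqrt 2 * artanh x)) x := by
    intro x hx
    have h := (hξ (Real.sqrt 2 * artanh x)).1.hasDerivAt.scomp x (my_hasDeriv hx)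
    have e : η = ξ ∘ fun y => Real.sqrt 2 * artanh y := funext hη
    rw [e]; exact h
  have hd2 : ∀ x ∈ Set.Ioo (-1 : ℝ) 1, HasDerivAt (deriv η)
      ((Real.sqrt 2 / (1 - x ^ 2)) • ((Real.sqrt 2 / (1 - x ^ 2)) •
          deriv (deriv ξ) (Real.sqrt 2 * artanh x)) +
        (Real.sqrt 2 * (2 * x) / (1 - x ^ 2) ^ 2) • deriv ξ (Real.sqrt 2 * artanh x)) x := by
    intro x hx
    have h := (hξ (Real.sqrt 2 * artanh x)).2.hasDerivAt.scomp x (my_hasDeriv hx)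
    refine ((my_hasDeriv2 hx).fun_smul h).congr_of_eventuallyEq ?_
    filter_upwards [isOpen_Ioo.mem_nhds hx] with y hy
    exact (hd1 y hy).deriv
  have key : ∀ x ∈ Set.Ioo (-1 : ℝ) 1,
      (1 - (x : ℂ) ^ 2) ^ 2 * deriv (deriv η) x -
          2 * (x : ℂ) * (1 - (x : ℂ) ^ 2) * deriv η x +
          (2 - 6 * (x : ℂ) ^ 2) * η x =
      2 * (deriv (deriv ξ) (Real.sqrt 2 * artanh x) -
        ((-1 + 3 * x ^ 2 : ℝ) : ℂ) * ξ (Real.sqrt 2 * artanh x)) := by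
    intro x hx
    rw [(hd1 x hx).deriv, (hd2 x hx).deriv, hη x]
    have h3 : (1 - x ^ 2) ≠ 0 := by nlinarith [hx.1, hx.2]
    have h4 : (1 - (x : ℂ) ^ 2) ≠ 0 := by exact_mod_cast h3
    have h5 : ((Real.sqrt 2 : ℝ) : ℂ) ^ 2 = 2 := by
      exact_mod_cast Real.sq_sqrt (show (0 : ℝ) ≤ 2 by norm_num)
    simp only [Complex.real_smul]
    push_cast
    generalize deriv (deriv ξ) (Real.sqrt 2 * artanh x) = A
    generalize deriv ξ (Real.sqrt 2 * artanh x) = B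
    generalize ξ (Real.sqrt 2 * artanh x) = C
    generalize ((Real.sqrt 2 : ℝ) : ℂ) = s at *
    field_simp
    linear_combination A * h5
  have hs : Real.sqrt 2 ≠ 0 := by positivity
  constructor
  · intro h
    refine ⟨fun x hx => ⟨(hd1 x hx).differentiableAt, (hd2 x hx).differentiableAt⟩, ?_⟩
    intro x hx
    rw [key x hx, h, mul_div_cancel_left₀ _ hs, my_artanh_eq hx, Real.tanh_artanh hx]
    simp
  · rintro ⟨-, h⟩ t
    have hx : Real.tanh (t / Real.sqrt 2) ∈ Set.Ioo (-1 : ℝ) 1 :=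
      ⟨Real.neg_one_lt_tanh _, Real.tanh_lt_one _⟩
    have h1 := h _ hx
    rw [key _ hx, my_artanh_eq hx, Real.artanh_tanh, mul_div_cancel₀ _ hs] at h1
    simpa [sub_eq_zero] using h1
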